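/- Let ρ ≥ 1, ϵ > 0, μ ∈ ℂ, and let z = R·exp(iθ) with R > 0 and −π/(2ρ) + π < θ < π/(2ρ) + π. Then E_{ρ,μ}(z) = ∫_{1+ϵ}^{∞} K_{ρ,μ}(r, z) dr + ∫_{−π/ρ−π}^{π/ρ−π} P_{ρ,μ}(1+ϵ, φ, z) dφ, where K_{ρ,μ}(r, z) := (ρ/π) · exp(ρ(1−μ)·(Real.log(R·r) + i(θ−π))) · exp(−exp(ρ·(Real.log(R·r) + i(θ−π)))) · [r·sin(π(1−μ)) + sin(π(1−μ) + π/ρ)] / (r² + 2r·cos(π/ρ) + 1). -/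

import Mathlib

open scoped Real
open MeasureTheory intervalIntegral

/-- The two-parameter Mittag-Leffler function
`E_{ρ,μ}(z) = ∑_{k=0}^∞ z^k / Γ(μ + k/ρ)`. -/
noncomputable def ML (ρ : ℝ) (μ z : ℂ) : ℂ :=
  ∑' k : ℕ, z ^ k * (Complex.Gamma (μ + (k : ℂ) / (ρ : ℂ)))⁻¹

/-- `φ_{ρ,μ}(ζ,z) = (ρ/(2πi)) exp((ζz)^ρ) (ζz)^{ρ(1-μ)}` at `ζ = r e^{iφ}`,
on the branch fixed by `arg z = θ`, `z = R e^{iθ}`. -/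
noncomputable def phiFun (ρ : ℝ) (μ : ℂ) (R θ r φ : ℝ) : ℂ :=
  ((ρ : ℂ) / (2 * (π : ℂ) * Complex.I)) *
    Complex.exp (Complex.exp ((ρ : ℂ) * ((Real.log (R * r) : ℂ) + Complex.I * ((θ + φ : ℝ) : ℂ)))) *
    Complex.exp ((ρ : ℂ) * (1 - μ) * ((Real.log (R * r) : ℂ) + Complex.I * ((θ + φ : ℝ) : ℂ)))

/-- The (complex-valued) phase function `η(r,φ)`. -/
noncomputable def etaF (ρ : ℝ) (μ : ℂ) (R θ r φ : ℝ) : ℂ :=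
  Complex.exp ((ρ : ℂ) * ((Real.log (R * r) : ℂ) + Complex.I * ((θ - π : ℝ) : ℂ))) *
      Complex.sin ((ρ : ℂ) * (φ : ℂ)) +
    (ρ : ℂ) * (1 - μ) * (φ : ℂ)

/-- The function `A_{ρ,μ}(r,ω₁,ω₂,z)`. -/
noncomputable def AF (ρ : ℝ) (μ : ℂ) (R θ r ω₁ ω₂ : ℝ) : ℂ :=
  Complex.exp (Complex.exp ((ρ : ℂ) * ((Real.log (R * r) : ℂ) + Complex.I * ((θ - π : ℝ) : ℂ))) *
      Complex.cos ((ρ : ℂ) * (ω₁ : ℂ))) *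
    ((r ^ 2 + 2 * r * Real.cos ω₂ + 1 : ℝ) : ℂ) *
    Complex.exp (Complex.I * etaF ρ μ R θ r ω₁) *
    ((r : ℂ) + Complex.exp (Complex.I * (ω₁ : ℂ)))

/-- The kernel `K_{ρ,μ}(r,φ₁,φ₂,z)`. -/
noncomputable def KF (ρ : ℝ) (μ : ℂ) (R θ r φ₁ φ₂ : ℝ) : ℂ :=
  ((ρ : ℂ) / (2 * (π : ℂ) * Complex.I)) *
    Complex.exp ((ρ : ℂ) * (1 - μ) * ((Real.log (R * r) : ℂ) + Complex.I * (θ : ℂ))) *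
    Complex.exp (-(Complex.I * (ρ : ℂ) * (π : ℂ) * (1 - μ))) *
    (AF ρ μ R θ r φ₂ φ₁ - AF ρ μ R θ r φ₁ φ₂) /
    (((r ^ 2 + 2 * r * Real.cos φ₁ + 1 : ℝ) : ℂ) * ((r ^ 2 + 2 * r * Real.cos φ₂ + 1 : ℝ) : ℂ))

/-- The (complex-valued) phase function `χ(r,φ)`. -/
noncomputable def chiF (ρ : ℝ) (μ : ℂ) (R θ r φ : ℝ) : ℂ :=
  Complex.exp ((ρ : ℂ) * ((Real.log (R * r) : ℂ) + Complex.I * (θ : ℂ))) *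
      Complex.sin ((ρ : ℂ) * (φ : ℂ)) +
    (ρ : ℂ) * (1 - μ) * (φ : ℂ)

/-- The kernel `P_{ρ,μ}(r,φ,z)`. -/
noncomputable def PF (ρ : ℝ) (μ : ℂ) (R θ r φ : ℝ) : ℂ :=
  ((ρ : ℂ) / (2 * (π : ℂ))) *
    Complex.exp (Complex.exp ((ρ : ℂ) * ((Real.log (R * r) : ℂ) + Complex.I * (θ : ℂ))) *
      Complex.cos ((ρ : ℂ) * (φ : ℂ))) *
    Complex.exp ((ρ : ℂ) * (1 - μ) * ((Real.log (R * r) : ℂ) + Complex.I * (θ : ℂ))) *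
    Complex.exp (Complex.I * chiF ρ μ R θ r φ) *
    ((r : ℂ) * ((r : ℂ) - Complex.exp (Complex.I * (φ : ℂ)))) /
    ((r ^ 2 - 2 * r * Real.cos φ + 1 : ℝ) : ℂ)

/-- The symmetric kernel `K_{ρ,μ}(r,φ,z)` (case `δ₁ρ = δ₂ρ`). -/
noncomputable def KsymF (ρ : ℝ) (μ : ℂ) (R θ r φ : ℝ) : ℂ :=
  ((ρ : ℂ) / (π : ℂ)) *
    Complex.exp ((ρ : ℂ) * (1 - μ) * ((Real.log (R * r) : ℂ) + Complex.I * ((θ - π : ℝ) : ℂ))) *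
    Complex.exp (Complex.exp ((ρ : ℂ) * ((Real.log (R * r) : ℂ) + Complex.I * ((θ - π : ℝ) : ℂ))) *
      Complex.cos ((ρ : ℂ) * (φ : ℂ))) *
    ((r : ℂ) * Complex.sin (etaF ρ μ R θ r φ) + Complex.sin (etaF ρ μ R θ r φ + (φ : ℂ))) /
    ((r ^ 2 + 2 * r * Real.cos φ + 1 : ℝ) : ℂ)

/-- The kernel `K_{ρ,μ}(r,z)` (case `δρ = π/ρ`). -/
noncomputable def KpiF (ρ : ℝ) (μ : ℂ) (R θ r : ℝ) : ℂ :=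
  ((ρ : ℂ) / (π : ℂ)) *
    Complex.exp ((ρ : ℂ) * (1 - μ) * ((Real.log (R * r) : ℂ) + Complex.I * ((θ - π : ℝ) : ℂ))) *
    Complex.exp (-Complex.exp ((ρ : ℂ) * ((Real.log (R * r) : ℂ) + Complex.I * ((θ - π : ℝ) : ℂ)))) *
    ((r : ℂ) * Complex.sin ((π : ℂ) * (1 - μ)) +
      Complex.sin ((π : ℂ) * (1 - μ) + (π : ℂ) / (ρ : ℂ))) /
    ((r ^ 2 + 2 * r * Real.cos (π / ρ) + 1 : ℝ) : ℂ)

/-- The kernel `K′_{ρ,μ}(r,φ,z)`. -/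
noncomputable def KpF (ρ : ℝ) (μ : ℂ) (R θ r φ : ℝ) : ℂ :=
  ((ρ : ℂ) / (2 * (π : ℂ) * Complex.I)) *
    Complex.exp (Complex.exp ((ρ : ℂ) * ((Real.log (R * r) : ℂ) + Complex.I * ((θ - π : ℝ) : ℂ))) *
      Complex.cos ((ρ : ℂ) * (φ : ℂ))) *
    Complex.exp ((ρ : ℂ) * (1 - μ) * ((Real.log (R * r) : ℂ) + Complex.I * (θ : ℂ))) *
    Complex.exp (Complex.I * (etaF ρ μ R θ r φ - (π : ℂ) * (ρ : ℂ) * (1 - μ))) *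
    ((r : ℂ) + Complex.exp (Complex.I * (φ : ℂ))) /
    ((r ^ 2 + 2 * r * Real.cos φ + 1 : ℝ) : ℂ)

/-- `r(τ,ψ) = √(τ² + 2τ cos ψ + 1)`. -/
noncomputable def rP (τ ψ : ℝ) : ℝ := Real.sqrt (τ ^ 2 + 2 * τ * Real.cos ψ + 1)

/-- `φ(τ,ψ,k) = arctan(τ sin ψ / (τ cos ψ + 1)) + kπ`. -/
noncomputable def phiP (τ ψ : ℝ) (k : ℤ) : ℝ :=
  Real.arctan (τ * Real.sin ψ / (τ * Real.cos ψ + 1)) + k * π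

/-- The (complex-valued) phase `χ′(τ,ψ,k,z)`. -/
noncomputable def chiP (ρ : ℝ) (μ : ℂ) (R θ τ ψ : ℝ) (k : ℤ) : ℂ :=
  Complex.exp ((ρ : ℂ) * ((Real.log (R * rP τ ψ) : ℂ) + Complex.I * (θ : ℂ))) *
      Complex.sin ((ρ : ℂ) * (phiP τ ψ k : ℂ)) +
    (ρ : ℂ) * (1 - μ) * (phiP τ ψ k : ℂ)

/-- The kernel `P′_{ρ,μ}(τ,ψ,k,z)`. -/
noncomputable def PpF (ρ : ℝ) (μ : ℂ) (R θ τ ψ : ℝ) (k : ℤ) : ℂ :=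
  ((ρ * τ : ℝ) : ℂ) / (2 * (π : ℂ)) *
    Complex.exp (Complex.exp ((ρ : ℂ) * ((Real.log (R * rP τ ψ) : ℂ) + Complex.I * (θ : ℂ))) *
      Complex.cos ((ρ : ℂ) * (phiP τ ψ k : ℂ))) *
    Complex.exp ((ρ : ℂ) * (1 - μ) * ((Real.log (R * rP τ ψ) : ℂ) + Complex.I * (θ : ℂ))) *
    Complex.exp (Complex.I * (chiP ρ μ R θ τ ψ k + (ψ : ℂ))) *
    ((rP τ ψ : ℂ) * Complex.exp (-(Complex.I * (phiP τ ψ k : ℂ))) - 1) /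
    ((rP τ ψ ^ 2 - 2 * rP τ ψ * Real.cos (phiP τ ψ k) + 1 : ℝ) : ℂ)

section

open Complex Set Filter Topology

/-- Cauchy's theorem on a half-strip unbounded to the left. -/
lemma integral_boundary_left_half_strip_eq_zero {F : ℂ → ℂ} (hF : Differentiable ℂ F)
    {y₀ y₁ a : ℝ} {B : ℝ → ℝ} (hB : Tendsto B atBot (𝓝 0))
    (hFB : ∀ x : ℝ, ∀ y ∈ uIoc y₀ y₁, ‖F (x + y * I)‖ ≤ B x)
    (h₀ : IntegrableOn (fun x : ℝ => F (x + y₀ * I)) (Iic a))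
    (h₁ : IntegrableOn (fun x : ℝ => F (x + y₁ * I)) (Iic a)) :
    (∫ x in Iic a, F (x + y₀ * I)) - (∫ x in Iic a, F (x + y₁ * I)) +
      I * ∫ y in y₀..y₁, F (a + y * I) = 0 := by
  have hrect (b : ℝ) := integral_boundary_rect_eq_zero_of_differentiableOn F
    (b + y₀ * I) (a + y₁ * I) hF.differentiableOn
  simp only [add_re, ofReal_re, mul_re, I_re, mul_zero, ofReal_im, I_im, mul_one, sub_self,
    add_zero, add_im, mul_im, zero_add, smul_eq_mul] at hrect
  have hvert : Tendsto (fun b : ℝ => ∫ y in y₀..y₁, F (b + y * I)) atBot (𝓝 0) := by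
    refine squeeze_zero_norm (a := fun b => B b * |y₁ - y₀|) (fun b => ?_) ?_
    · exact intervalIntegral.norm_integral_le_of_norm_le_const (hFB b)
    · simpa using hB.mul_const |y₁ - y₀|
  have hlim := (((intervalIntegral_tendsto_integral_Iic a h₀ tendsto_id).sub
    (intervalIntegral_tendsto_integral_Iic a h₁ tendsto_id)).add_const
      (I * ∫ y in y₀..y₁, F (a + y * I))).sub (hvert.const_mul I)
  simp only [id, hrect, mul_zero, sub_zero] at hlim
  exact (tendsto_nhds_unique hlim tendsto_const_nhds)

/-- The integrals of an entire function over two horizontal lines agree when it decays uniformly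
between them. -/
lemma integral_horizontal_line_eq {F : ℂ → ℂ} (hF : Differentiable ℂ F)
    {y₀ y₁ : ℝ} {B : ℝ → ℝ} (hB : Tendsto B atBot (𝓝 0)) (hB' : Tendsto B atTop (𝓝 0))
    (hFB : ∀ x : ℝ, ∀ y ∈ uIoc y₀ y₁, ‖F (x + y * I)‖ ≤ B x)
    (h₀ : Integrable (fun x : ℝ => F (x + y₀ * I)))
    (h₁ : Integrable (fun x : ℝ => F (x + y₁ * I))) :
    ∫ x : ℝ, F (x + y₀ * I) = ∫ x : ℝ, F (x + y₁ * I) := by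
  have hlim : Tendsto (fun a : ℝ => (∫ x in Iic a, F (x + y₀ * I)) -
      (∫ x in Iic a, F (x + y₁ * I)) + I * ∫ y in y₀..y₁, F (a + y * I)) atTop
      (𝓝 ((∫ x : ℝ, F (x + y₀ * I)) - (∫ x : ℝ, F (x + y₁ * I)) + I * 0)) := by
    refine (((aecover_Iic tendsto_id).integral_tendsto_of_countably_generated h₀).sub
      ((aecover_Iic tendsto_id).integral_tendsto_of_countably_generated h₁)).add (Tendsto.const_mul I ?_)
    refine squeeze_zero_norm (a := fun b => B b * |y₁ - y₀|) (fun b => ?_) ?_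
    · exact intervalIntegral.norm_integral_le_of_norm_le_const (hFB b)
    · simpa using hB'.mul_const |y₁ - y₀|
  have hz (a : ℝ) := integral_boundary_left_half_strip_eq_zero hF (a := a) hB hFB
    h₀.integrableOn h₁.integrableOn
  simp only [hz] at hlim
  have := tendsto_nhds_unique hlim tendsto_const_nhds
  simpa [sub_eq_zero] using this

lemma tendsto_exp_neg_mul_exp_add_atTop {c : ℝ} (hc : 0 < c) (m : ℝ) :
    Tendsto (fun x : ℝ => Real.exp (-(c * Real.exp x) + m * x)) atTop (𝓝 0) := by
  refine Real.tendsto_exp_atBot.comp ?_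
  have h1 : Tendsto (fun x : ℝ => Real.exp x / x ^ 1) atTop atTop :=
    Real.tendsto_exp_div_pow_atTop 1
  have h2 : Tendsto (fun x : ℝ => x * (c * (Real.exp x / x ^ 1) - m)) atTop atTop :=
    tendsto_id.atTop_mul_atTop₀ (tendsto_atTop_add_const_right _ _ (h1.const_mul_atTop hc))
  refine (tendsto_neg_atTop_atBot.comp h2).congr' ?_
  filter_upwards [eventually_gt_atTop 0] with x hx
  simp only [Function.comp]
  field_simp
  ring

lemma integrableOn_exp_neg_mul_exp_add_Ioi {c : ℝ} (hc : 0 < c) (m a : ℝ) :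
    IntegrableOn (fun x : ℝ => Real.exp (-(c * Real.exp x) + m * x)) (Ioi a) := by
  refine integrable_of_isBigO_exp_neg one_pos (by fun_prop) ?_
  refine ((Asymptotics.isLittleO_iff_tendsto fun x hx => absurd hx (Real.exp_ne_zero _)).2
    ((tendsto_exp_neg_mul_exp_add_atTop hc (m + 1)).congr fun x => ?_)).isBigO
  rw [← Real.exp_sub]
  ring_nf

lemma integrable_exp_neg_mul_exp_add {c m : ℝ} (hc : 0 < c) (hm : 0 < m) :
    Integrable (fun x : ℝ => Real.exp (-(c * Real.exp x) + m * x)) := by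
  rw [← integrableOn_univ, ← Iic_union_Ioi (a := (0 : ℝ)), integrableOn_union]
  refine ⟨(integrableOn_exp_mul_Iic hm 0).mono' (by fun_prop) (ae_of_all _ fun x => ?_),
    integrableOn_exp_neg_mul_exp_add_Ioi hc m 0⟩
  rw [Real.norm_eq_abs, Real.abs_exp, Real.exp_le_exp]
  have := mul_pos hc (Real.exp_pos x)
  linarith

lemma norm_exp_neg_exp_add_mul (m : ℂ) (x y : ℝ) :
    ‖exp (-exp (x + y * I) + m * (x + y * I))‖ =
      Real.exp (-m.im * y) * Real.exp (-(Real.cos y * Real.exp x) + m.re * x) := by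
  rw [norm_exp, ← Real.exp_add]
  congr 1
  simp [exp_re]
  ring

/-- Euler's integral for the Gamma function in exponential coordinates, along a rotated ray. -/
lemma integral_exp_neg_exp_add_mul {m : ℂ} (hm : 0 < m.re) {α : ℝ} (hα : |α| < π / 2) :
    ∫ x : ℝ, exp (-exp (x + α * I) + m * (x + α * I)) = Gamma m := by
  have hcos : 0 < Real.cos α := Real.cos_pos_of_mem_Ioo (abs_lt.1 hα)
  have hint : ∀ y : ℝ, 0 < Real.cos y →
      Integrable (fun x : ℝ => exp (-exp (x + y * I) + m * (x + y * I))) := fun y hy => by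
    refine ((integrable_exp_neg_mul_exp_add hy hm).const_mul (Real.exp (-m.im * y))).mono'
      (by fun_prop) (ae_of_all _ fun x => ?_)
    rw [norm_exp_neg_exp_add_mul]
  have hrot := integral_horizontal_line_eq (F := fun L => exp (-exp L + m * L))
    (y₀ := 0) (y₁ := α)
    (B := fun x => Real.exp (|m.im| * |α|) *
      Real.exp (-(Real.cos α * Real.exp x) + m.re * x)) (by fun_prop) ?_ ?_ ?_
      (hint 0 (by simp)) (hint α hcos)
  · rw [← hrot, Gamma_eq_integral hm, GammaIntegral, ← Real.range_exp, ← image_univ,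
      integral_image_eq_integral_abs_deriv_smul MeasurableSet.univ
        (fun x _ => (Real.hasDerivAt_exp x).hasDerivWithinAt) Real.exp_injective.injOn,
      Measure.restrict_univ]
    refine integral_congr_ae (ae_of_all _ fun x => ?_)
    simp only [ofReal_zero, zero_mul, add_zero, Real.abs_exp, real_smul]
    rw [cpow_def_of_ne_zero (ofReal_ne_zero.2 (Real.exp_ne_zero x)),
      ← ofReal_log (Real.exp_pos x).le, Real.log_exp]
    push_cast
    rw [← exp_add, ← exp_add]
    congr 1
    ring
  · have h1 : Tendsto (fun x : ℝ => Real.exp (-(Real.cos α * Real.exp x) + m.re * x)) atBot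
        (𝓝 0) := by
      refine Real.tendsto_exp_atBot.comp ?_
      refine tendsto_atBot_mono (fun x => ?_) (tendsto_id.const_mul_atBot hm)
      have := mul_pos hcos (Real.exp_pos x)
      simp only [id]
      linarith
    simpa using h1.const_mul (Real.exp (|m.im| * |α|))
  · simpa using (tendsto_exp_neg_mul_exp_add_atTop hcos m.re).const_mul
      (Real.exp (|m.im| * |α|))
  · intro x y hy
    rw [norm_exp_neg_exp_add_mul]
    have hy' : |y| ≤ |α| := by
      simpa using abs_sub_left_of_mem_uIcc (uIoc_subset_uIcc hy)
    have h1 : -m.im * y ≤ |m.im| * |α| := by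
      calc -m.im * y ≤ |(-m.im) * y| := le_abs_self _
        _ = |m.im| * |y| := by rw [abs_mul, abs_neg]
        _ ≤ _ := by gcongr
    have h2 : Real.cos α ≤ Real.cos y := by
      rw [← Real.cos_abs α, ← Real.cos_abs y]
      exact Real.cos_le_cos_of_nonneg_of_le_pi (abs_nonneg _) (by linarith [Real.pi_pos]) hy'
    gcongr

end

section

open Complex Set Filter Topology

/-- The integrand of Hankel's representation of `1 / Γ(s)` in the logarithmic variable. -/
noncomputable def hankelKernel (s L : ℂ) : ℂ := exp (exp L + (1 - s) * L)

/-- The integral over the Hankel contour in the logarithmic variable: two horizontal rays at heights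
`α ± π`, joined by a vertical segment over `a`. -/
noncomputable def hankelIntegral (α a : ℝ) (f : ℂ → ℂ) : ℂ :=
  (∫ x in Ioi a, f (x + (α + π : ℝ) * I)) - (∫ x in Ioi a, f (x + (α - π : ℝ) * I)) +
    I * ∫ y in (α - π)..(α + π), f (a + y * I)

lemma differentiable_hankelKernel (s : ℂ) : Differentiable ℂ (hankelKernel s) := by
  unfold hankelKernel; fun_prop

lemma hankelKernel_add_pi (s : ℂ) (x α : ℝ) : hankelKernel s (x + (α + π : ℝ) * I) =
    exp ((1 - s) * (π * I)) * exp (-exp (x + α * I) + (1 - s) * (x + α * I)) := by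
  have h : (x : ℂ) + (α + π : ℝ) * I = x + α * I + π * I := by push_cast; ring
  rw [hankelKernel, h, exp_add _ (π * I), exp_pi_mul_I, ← exp_add]
  congr 1
  ring

lemma hankelKernel_sub_pi (s : ℂ) (x α : ℝ) : hankelKernel s (x + (α - π : ℝ) * I) =
    exp (-((1 - s) * (π * I))) * exp (-exp (x + α * I) + (1 - s) * (x + α * I)) := by
  have h : (x : ℂ) + (α - π : ℝ) * I = x + α * I - π * I := by push_cast; ring
  rw [hankelKernel, h, exp_sub _ (π * I), exp_pi_mul_I, ← exp_add]
  congr 1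
  ring

lemma integrableOn_exp_neg_exp_add_mul_Ioi {α : ℝ} (hα : |α| < π / 2) (m : ℂ) (a : ℝ) :
    IntegrableOn (fun x : ℝ => exp (-exp (x + α * I) + m * (x + α * I))) (Ioi a) := by
  refine ((integrableOn_exp_neg_mul_exp_add_Ioi (Real.cos_pos_of_mem_Ioo (abs_lt.1 hα))
    m.re a).const_mul (Real.exp (-m.im * α))).mono' (by fun_prop) (ae_of_all _ fun x => ?_)
  rw [norm_exp_neg_exp_add_mul]

lemma integrable_exp_neg_exp_add_mul {α : ℝ} (hα : |α| < π / 2) {m : ℂ} (hm : 0 < m.re) :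
    Integrable (fun x : ℝ => exp (-exp (x + α * I) + m * (x + α * I))) := by
  refine ((integrable_exp_neg_mul_exp_add (Real.cos_pos_of_mem_Ioo (abs_lt.1 hα))
    hm).const_mul (Real.exp (-m.im * α))).mono' (by fun_prop) (ae_of_all _ fun x => ?_)
  rw [norm_exp_neg_exp_add_mul]

lemma integrableOn_hankelKernel_add_pi {α : ℝ} (hα : |α| < π / 2) (s : ℂ) (a : ℝ) :
    IntegrableOn (fun x : ℝ => hankelKernel s (x + (α + π : ℝ) * I)) (Ioi a) := by
  simp only [hankelKernel_add_pi]
  exact (integrableOn_exp_neg_exp_add_mul_Ioi hα _ a).const_mul _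

lemma integrableOn_hankelKernel_sub_pi {α : ℝ} (hα : |α| < π / 2) (s : ℂ) (a : ℝ) :
    IntegrableOn (fun x : ℝ => hankelKernel s (x + (α - π : ℝ) * I)) (Ioi a) := by
  simp only [hankelKernel_sub_pi]
  exact (integrableOn_exp_neg_exp_add_mul_Ioi hα _ a).const_mul _

lemma hankelIntegral_hankelKernel_of_re_lt_one {α : ℝ} (hα : |α| < π / 2) (a : ℝ) {s : ℂ}
    (hs : s.re < 1) :
    hankelIntegral α a (hankelKernel s) = 2 * π * I * (Gamma s)⁻¹ := by
  have hm : 0 < (1 - s).re := by simpa using hs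
  have hplus : Integrable (fun x : ℝ => hankelKernel s (x + (α + π : ℝ) * I)) := by
    simp only [hankelKernel_add_pi]
    exact (integrable_exp_neg_exp_add_mul hα hm).const_mul _
  have hminus : Integrable (fun x : ℝ => hankelKernel s (x + (α - π : ℝ) * I)) := by
    simp only [hankelKernel_sub_pi]
    exact (integrable_exp_neg_exp_add_mul hα hm).const_mul _
  have hstrip := integral_boundary_left_half_strip_eq_zero (differentiable_hankelKernel s)
    (y₀ := α - π) (y₁ := α + π) (a := a)
    (B := fun x => Real.exp (Real.exp x + (1 - s).re * x + |(1 - s).im| * (|α| + π)))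
    ?_ ?_ hminus.integrableOn hplus.integrableOn
  · have hp := integral_Iic_add_Ioi (b := a) hplus.integrableOn hplus.integrableOn
    have hq := integral_Iic_add_Ioi (b := a) hminus.integrableOn hminus.integrableOn
    have key : hankelIntegral α a (hankelKernel s) =
        (∫ x : ℝ, hankelKernel s (x + (α + π : ℝ) * I)) -
          ∫ x : ℝ, hankelKernel s (x + (α - π : ℝ) * I) := by
      rw [hankelIntegral, ← hp, ← hq]
      linear_combination hstrip
    have hsin : exp ((1 - s) * (π * I)) - exp (-((1 - s) * (π * I))) =
        2 * I * sin (π * s) := by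
      have h1 : (1 - s) * (π * I) = π * I - π * s * I := by ring
      rw [h1, neg_sub, exp_sub, exp_sub, exp_pi_mul_I, sin, neg_mul, exp_neg]
      have := exp_ne_zero (π * s * I)
      field_simp
      ring_nf
      simp only [I_sq]
      ring
    rw [key]
    simp only [hankelKernel_add_pi, hankelKernel_sub_pi]
    rw [MeasureTheory.integral_const_mul, MeasureTheory.integral_const_mul,
      integral_exp_neg_exp_add_mul hm hα, ← sub_mul, hsin]
    have href := Gamma_mul_Gamma_one_sub s
    have hG := Gamma_ne_zero_of_re_pos hm
    by_cases h0 : sin (π * s) = 0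
    · rw [h0, div_zero] at href
      rw [h0, (mul_eq_zero.1 href).resolve_right hG]
      simp
    · have hπ : (π : ℂ) ≠ 0 := ofReal_ne_zero.2 Real.pi_ne_zero
      rw [eq_div_iff h0] at href
      have hG' : Gamma s ≠ 0 := fun h => by simp [h, hπ, eq_comm] at href
      field_simp
      linear_combination href
  · refine Real.tendsto_exp_atBot.comp (tendsto_atBot_add_const_right _ _ ?_)
    exact Real.tendsto_exp_atBot.add_atBot (tendsto_id.const_mul_atBot hm)
  · intro x y hy
    rw [hankelKernel, norm_exp, Real.exp_le_exp]
    have hy' : |y| ≤ |α| + π := by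
      have h1 := uIoc_subset_uIcc hy
      rw [uIcc_of_le (by linarith [Real.pi_pos]), mem_Icc] at h1
      rw [abs_le]
      constructor <;> linarith [le_abs_self α, neg_abs_le α]
    have h2 : -((1 - s).im * y) ≤ |(1 - s).im| * (|α| + π) := by
      calc _ ≤ |(1 - s).im * y| := neg_le_abs _
        _ = |(1 - s).im| * |y| := abs_mul _ _
        _ ≤ _ := by gcongr
    have h3 : Real.exp x * Real.cos y ≤ Real.exp x :=
      mul_le_of_le_one_right (Real.exp_pos x).le (Real.cos_le_one y)
    have h4 : (exp (x + y * I) + (1 - s) * (x + y * I)).re =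
        Real.exp x * Real.cos y + (1 - s).re * x + -((1 - s).im * y) := by
      simp [exp_re]
      ring
    rw [h4]
    linarith

lemma hasDerivAt_hankelKernel (s L : ℂ) :
    HasDerivAt (hankelKernel (s + 1)) (hankelKernel s L - s * hankelKernel (s + 1) L) L := by
  have h := ((hasDerivAt_exp L).add ((hasDerivAt_id L).const_mul (1 - (s + 1)))).cexp
  refine h.congr_deriv ?_
  have h1 : exp L + (1 - s) * L = exp L + (1 - (s + 1)) * L + L := by ring
  simp only [hankelKernel, h1, Pi.add_apply, id]
  rw [exp_add _ L]
  ring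

lemma hankelKernel_tendsto_zero {α : ℝ} (hα : |α| < π / 2) (s : ℂ) :
    Tendsto (fun x : ℝ => exp (-exp (x + α * I) + (1 - s) * (x + α * I))) atTop (𝓝 0) := by
  rw [tendsto_zero_iff_norm_tendsto_zero]
  simp only [norm_exp_neg_exp_add_mul]
  simpa using (tendsto_exp_neg_mul_exp_add_atTop
    (Real.cos_pos_of_mem_Ioo (abs_lt.1 hα)) (1 - s).re).const_mul (Real.exp (-(1 - s).im * α))

/-- Integration by parts over the Hankel contour. -/
lemma hankelIntegral_hankelKernel_eq_mul {α : ℝ} (hα : |α| < π / 2) (a : ℝ) (s : ℂ) :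
    hankelIntegral α a (hankelKernel s) = s * hankelIntegral α a (hankelKernel (s + 1)) := by
  have hray (y : ℝ) (ht : Tendsto (fun x : ℝ => hankelKernel (s + 1) (x + y * I)) atTop (𝓝 0))
      (h₀ : IntegrableOn (fun x : ℝ => hankelKernel s (x + y * I)) (Ioi a))
      (h₁ : IntegrableOn (fun x : ℝ => hankelKernel (s + 1) (x + y * I)) (Ioi a)) :
      (∫ x in Ioi a, hankelKernel s (x + y * I)) -
        s * (∫ x in Ioi a, hankelKernel (s + 1) (x + y * I)) =
        -hankelKernel (s + 1) (a + y * I) := by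
    rw [← MeasureTheory.integral_const_mul, ← MeasureTheory.integral_sub h₀ (h₁.const_mul s)]
    have hd (x : ℝ) : HasDerivAt (fun x : ℝ => hankelKernel (s + 1) (x + y * I))
        (hankelKernel s (x + y * I) - s * hankelKernel (s + 1) (x + y * I)) x := by
      simpa using ((hasDerivAt_hankelKernel s (x + y * I)).comp (x : ℂ)
        ((hasDerivAt_id (x : ℂ)).add_const (y * I))).comp_ofReal
    rw [integral_Ioi_of_hasDerivAt_of_tendsto (hd a).continuousAt.continuousWithinAt
      (fun x _ => hd x) (h₀.sub (h₁.const_mul s)) ht, zero_sub]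
  have hp := hray (α + π)
    (by simpa only [hankelKernel_add_pi, mul_zero] using
      (hankelKernel_tendsto_zero hα (s + 1)).const_mul _)
    (integrableOn_hankelKernel_add_pi hα s a) (integrableOn_hankelKernel_add_pi hα (s + 1) a)
  have hq := hray (α - π)
    (by simpa only [hankelKernel_sub_pi, mul_zero] using
      (hankelKernel_tendsto_zero hα (s + 1)).const_mul _)
    (integrableOn_hankelKernel_sub_pi hα s a) (integrableOn_hankelKernel_sub_pi hα (s + 1) a)
  have hcont (s : ℂ) : Continuous fun y : ℝ => hankelKernel s (a + y * I) :=
    (differentiable_hankelKernel s).continuous.comp (by fun_prop)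
  have hseg : I * (∫ y in (α - π)..(α + π), hankelKernel s (a + y * I)) -
      s * (I * ∫ y in (α - π)..(α + π), hankelKernel (s + 1) (a + y * I)) =
      hankelKernel (s + 1) (a + (α + π : ℝ) * I) - hankelKernel (s + 1) (a + (α - π : ℝ) * I) := by
    rw [mul_left_comm s, ← mul_sub, ← intervalIntegral.integral_const_mul,
      ← intervalIntegral.integral_sub ((hcont s).intervalIntegrable _ _)
        (((hcont (s + 1)).const_mul s).intervalIntegrable _ _),
      ← intervalIntegral.integral_const_mul]
    refine integral_eq_sub_of_hasDerivAt (f := fun y : ℝ => hankelKernel (s + 1) (a + y * I))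
      (fun y _ => ?_) ?_
    · have hd := ((hasDerivAt_hankelKernel s (a + y * I)).comp (y : ℂ)
        (((hasDerivAt_id (y : ℂ)).mul_const I).const_add (a : ℂ))).comp_ofReal
      refine hd.congr_deriv ?_
      ring
    · exact (((hcont s).sub ((hcont (s + 1)).const_mul s)).const_mul I).intervalIntegrable _ _
  rw [hankelIntegral, hankelIntegral]
  linear_combination hp - hq + hseg

lemma hankelIntegral_hankelKernel_one (α a : ℝ) :
    hankelIntegral α a (hankelKernel 1) = 2 * π * I := by
  have hper (x : ℝ) : hankelKernel 1 (x + (α + π : ℝ) * I) =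
      hankelKernel 1 (x + (α - π : ℝ) * I) := by
    rw [hankelKernel_add_pi, hankelKernel_sub_pi]
    simp
  have hcirc := circleIntegral_sub_inv_smul_of_differentiable_on_off_countable (R := Real.exp a)
    (c := 0) (w := 0) (f := exp) countable_empty (by simp [Real.exp_pos])
    continuous_exp.continuousOn (fun x _ => differentiable_exp x)
  have hP : Function.Periodic (fun y : ℝ => hankelKernel 1 (a + y * I)) (2 * π) := fun y => by
    have h := hankelKernel_add_pi 1 a (y + π)
    have h' := hankelKernel_sub_pi 1 a (y + π)
    rw [show y + π + π = y + 2 * π by ring] at h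
    rw [add_sub_cancel_right] at h'
    simp only [h, h', sub_self, zero_mul, neg_zero]
  have hseg : I * ∫ y in (α - π)..(α + π), hankelKernel 1 (a + y * I) = 2 * π * I := by
    have h := hP.intervalIntegral_add_eq (α - π) 0
    rw [show α - π + 2 * π = α + π by ring, zero_add] at h
    rw [h, ← intervalIntegral.integral_const_mul]
    rw [circleIntegral] at hcirc
    simp only [smul_eq_mul, exp_zero, mul_one] at hcirc
    rw [← hcirc]
    refine intervalIntegral.integral_congr fun y _ => ?_
    have hne : circleMap 0 (Real.exp a) y ≠ 0 := circleMap_ne_center (Real.exp_pos a).ne'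
    have hmap : circleMap 0 (Real.exp a) y = exp (a + y * I) := by
      simp [circleMap, exp_add]
    simp only [deriv_circleMap, sub_zero, hankelKernel, sub_self, zero_mul, add_zero, ← hmap]
    field_simp
  simp only [hankelIntegral, hseg, hper, sub_self, zero_add]

/-- **Hankel's formula** for the reciprocal Gamma function. -/
theorem hankelIntegral_hankelKernel {α : ℝ} (hα : |α| < π / 2) (a : ℝ) (s : ℂ) :
    hankelIntegral α a (hankelKernel s) = 2 * π * I * (Gamma s)⁻¹ := by
  obtain ⟨n, hn⟩ := exists_nat_gt s.re
  induction n generalizing s with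
  | zero =>
    exact hankelIntegral_hankelKernel_of_re_lt_one hα a (hn.trans (by simp))
  | succ n ih =>
    by_cases hs : s = 1
    · rw [hs, hankelIntegral_hankelKernel_one, Gamma_one, inv_one, mul_one]
    · have hs' : s - 1 ≠ 0 := sub_ne_zero.2 hs
      have h1 := ih (s - 1) (by push_cast at hn; simp; linarith)
      have h2 := hankelIntegral_hankelKernel_eq_mul hα a (s - 1)
      rw [sub_add_cancel] at h2
      have h3 := one_div_Gamma_eq_self_mul_one_div_Gamma_add_one (s - 1)
      rw [sub_add_cancel] at h3
      refine mul_left_cancel₀ hs' ?_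
      rw [← h2, h1, h3]
      ring

end

section

open Complex Set Filter Topology

lemma integrable_div_one_sub {X : Type*} [MeasurableSpace X] {ν : Measure X} {f q : X → ℂ}
    (hf : Integrable f ν) (hq : AEStronglyMeasurable q ν) {κ : ℝ} (hκ : κ < 1)
    (hqκ : ∀ᵐ x ∂ν, ‖q x‖ ≤ κ) : Integrable (fun x => f x / (1 - q x)) ν := by
  simp only [div_eq_mul_inv]
  refine hf.mul_bdd (c := (1 - κ)⁻¹)
    ((aestronglyMeasurable_const.sub hq).aemeasurable.inv.aestronglyMeasurable) ?_
  filter_upwards [hqκ] with x hx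
  rw [norm_inv]
  refine inv_anti₀ (by linarith) ?_
  have := norm_sub_norm_le 1 (q x)
  rw [norm_one] at this
  linarith

/-- Termwise integration of a geometric series. -/
lemma hasSum_integral_mul_pow {X : Type*} [MeasurableSpace X] {ν : Measure X} {f q : X → ℂ}
    (hf : Integrable f ν) (hq : AEStronglyMeasurable q ν) {κ : ℝ} (hκ₀ : 0 ≤ κ) (hκ : κ < 1)
    (hqκ : ∀ᵐ x ∂ν, ‖q x‖ ≤ κ) :
    HasSum (fun k : ℕ => ∫ x, f x * q x ^ k ∂ν) (∫ x, f x / (1 - q x) ∂ν) := by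
  have hsum := summable_geometric_of_lt_one hκ₀ hκ
  refine MeasureTheory.hasSum_integral_of_dominated_convergence
    (fun k x => ‖f x‖ * κ ^ k) (fun k => hf.1.mul (hq.pow k)) (fun k => ?_)
    (ae_of_all _ fun x => hsum.mul_left _) ?_ ?_
  · filter_upwards [hqκ] with x hx
    rw [norm_mul, norm_pow]
    gcongr
  · simp only [tsum_mul_left]
    exact hf.norm.mul_const _
  · filter_upwards [hqκ] with x hx
    rw [div_eq_mul_inv]
    exact (hasSum_geometric_of_norm_lt_one (hx.trans_lt hκ)).mul_left _

lemma pow_mul_hankelKernel (ρ : ℝ) (μ z L : ℂ) (k : ℕ) :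
    z ^ k * hankelKernel (μ + k / ρ) L = hankelKernel μ L * (z * exp (-L / ρ)) ^ k := by
  rw [mul_pow, ← exp_nat_mul, mul_left_comm, hankelKernel, hankelKernel, ← exp_add]
  congr 2
  ring

lemma norm_mul_exp_neg_div (ρ : ℝ) (z : ℂ) (x y : ℝ) :
    ‖z * exp (-(x + y * I) / ρ)‖ = ‖z‖ * Real.exp (-x / ρ) := by
  rw [norm_mul, norm_exp, div_ofReal_re]
  simp

lemma hankelIntegral_congr_const_mul {α a : ℝ} {f g : ℂ → ℂ} {c : ℂ} (h : ∀ L, c * f L = g L) :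
    c * hankelIntegral α a f = hankelIntegral α a g := by
  simp only [hankelIntegral, ← h, MeasureTheory.integral_const_mul,
    intervalIntegral.integral_const_mul]
  ring

lemma hasSum_hankelIntegral {α a ρ : ℝ} (hα : |α| < π / 2) (hρ : 0 < ρ) (μ : ℂ) {z : ℂ}
    (hz : ‖z‖ * Real.exp (-a / ρ) < 1) :
    HasSum (fun k : ℕ => z ^ k * hankelIntegral α a (hankelKernel (μ + k / ρ)))
      (hankelIntegral α a fun L => hankelKernel μ L / (1 - z * exp (-L / ρ))) := by
  have hterm (k : ℕ) := hankelIntegral_congr_const_mul (α := α) (a := a)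
    (pow_mul_hankelKernel ρ μ z · k)
  simp only [hterm]
  have hκ₀ : 0 ≤ ‖z‖ * Real.exp (-a / ρ) := by positivity
  have hq (x y : ℝ) (hx : a ≤ x) : ‖z * exp (-(x + y * I) / ρ)‖ ≤ ‖z‖ * Real.exp (-a / ρ) := by
    rw [norm_mul_exp_neg_div]
    gcongr
  have hray (y : ℝ) (h : IntegrableOn (fun x : ℝ => hankelKernel μ (x + y * I)) (Ioi a)) :=
    hasSum_integral_mul_pow h (q := fun x : ℝ => z * exp (-(x + y * I) / ρ))
      (by fun_prop) hκ₀ hz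
      ((ae_restrict_iff' measurableSet_Ioi).2 (ae_of_all _ fun x hx => hq x y (le_of_lt hx)))
  have hcont : Continuous fun y : ℝ => hankelKernel μ (a + y * I) :=
    (differentiable_hankelKernel μ).continuous.comp (by fun_prop)
  have hseg := hasSum_integral_mul_pow (ν := volume.restrict (Ioc (α - π) (α + π)))
    (hcont.intervalIntegrable (α - π) (α + π)).1
    (q := fun y : ℝ => z * exp (-(a + y * I) / ρ))
      (by fun_prop) hκ₀ hz (ae_of_all _ fun y => hq a y le_rfl)
  simp only [← intervalIntegral.integral_of_le
    (show α - π ≤ α + π by linarith [Real.pi_pos])] at hseg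
  exact ((hray _ (integrableOn_hankelKernel_add_pi hα μ a)).sub
    (hray _ (integrableOn_hankelKernel_sub_pi hα μ a))).add (hseg.mul_left I)

/-- The Mittag-Leffler function as an integral over the Hankel contour. -/
lemma two_pi_I_mul_ML {α a ρ : ℝ} (hα : |α| < π / 2) (hρ : 0 < ρ) (μ : ℂ) {z : ℂ}
    (hz : ‖z‖ * Real.exp (-a / ρ) < 1) :
    2 * π * I * ML ρ μ z =
      hankelIntegral α a fun L => hankelKernel μ L / (1 - z * exp (-L / ρ)) := by
  rw [← (hasSum_hankelIntegral hα hρ μ hz).tsum_eq, ML, ← tsum_mul_left]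
  refine tsum_congr fun k => ?_
  rw [hankelIntegral_hankelKernel hα]
  ring

lemma integral_Ioi_comp_mul_log {ρ R b : ℝ} (hρ : 0 < ρ) (hR : 0 < R) (hb : 0 < b) (g : ℝ → ℂ) :
    ∫ r in Ioi b, ((ρ / r : ℝ) : ℂ) * g (ρ * Real.log (R * r)) =
      ∫ x in Ioi (ρ * Real.log (R * b)), g x := by
  have hmono : StrictMonoOn (fun r => ρ * Real.log (R * r)) (Ioi 0) := fun r hr r' hr' h =>
    mul_lt_mul_of_pos_left (Real.log_lt_log (mul_pos hR hr) (mul_lt_mul_of_pos_left h hR)) hρ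
  have himage : (fun r => ρ * Real.log (R * r)) '' Ioi b = Ioi (ρ * Real.log (R * b)) := by
    ext x
    constructor
    · rintro ⟨r, hr, rfl⟩
      exact hmono hb (hb.trans hr) hr
    · intro hx
      have hx' : ρ * Real.log (R * (Real.exp (x / ρ) / R)) = x := by
        rw [mul_div_cancel₀ _ hR.ne', Real.log_exp, mul_div_cancel₀ _ hρ.ne']
      refine ⟨Real.exp (x / ρ) / R, ?_, hx'⟩
      rw [mem_Ioi, ← hx'] at hx
      exact (hmono.lt_iff_lt hb (div_pos (Real.exp_pos _) hR)).1 hx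
  rw [← himage, integral_image_eq_integral_abs_deriv_smul (f' := fun r => ρ / r)
    measurableSet_Ioi (fun r hr => ?_) (hmono.injOn.mono fun r hr => hb.trans hr)]
  · refine setIntegral_congr_fun measurableSet_Ioi fun r hr => ?_
    simp only [abs_of_pos (div_pos hρ (hb.trans hr)), real_smul]
  · have hr0 : 0 < r := hb.trans hr
    have h := (((hasDerivAt_id r).const_mul R).log (mul_pos hR hr0).ne').const_mul ρ
    refine (h.congr_deriv ?_).hasDerivWithinAt
    simp only [id]
    field_simp

lemma ofReal_add_exp_ne_zero {r : ℝ} (hr : 1 < r) (x : ℝ) :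
    (r : ℂ) + exp (x * I) ≠ 0 := fun h => by
  have h1 := congrArg norm (eq_neg_of_add_eq_zero_left h)
  rw [norm_neg, norm_exp_ofReal_mul_I, norm_real, Real.norm_eq_abs, abs_of_pos (by linarith)] at h1
  linarith

lemma mul_exp_neg_div_eq {ρ R θ r : ℝ} (hρ : 0 < ρ) (hR : 0 < R) (hr : 0 < r) (ψ : ℝ) :
    (R : ℂ) * exp (I * θ) * exp (-((ρ * Real.log (R * r) : ℝ) + (ρ * (θ + ψ) : ℝ) * I) / ρ) =
      exp ((-ψ : ℝ) * I) / r := by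
  have hρ' : (ρ : ℂ) ≠ 0 := ofReal_ne_zero.2 hρ.ne'
  have hR' : (R : ℂ) ≠ 0 := ofReal_ne_zero.2 hR.ne'
  have h1 : exp (-((ρ * Real.log (R * r) : ℝ) + (ρ * (θ + ψ) : ℝ) * I) / ρ) =
      exp (-(Real.log (R * r) : ℝ)) * exp (-(I * θ)) * exp ((-ψ : ℝ) * I) := by
    rw [← exp_add, ← exp_add]
    congr 1
    push_cast
    field_simp
    ring
  rw [h1, exp_neg, ← ofReal_exp, Real.exp_log (mul_pos hR hr), exp_neg (I * θ)]
  have := exp_ne_zero (I * θ)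
  push_cast
  field_simp

lemma KpiF_eq {ρ R θ r : ℝ} (μ : ℂ) (hρ : 0 < ρ) (hR : 0 < R) (hr : 1 < r)
    {G : ℂ → ℂ} (hG : ∀ L, G L = hankelKernel μ L /
      (1 - (R : ℂ) * exp (I * θ) * exp (-L / ρ))) :
    2 * π * I * KpiF ρ μ R θ r = ((ρ / r : ℝ) : ℂ) *
      (G ((ρ * Real.log (R * r) : ℝ) + (ρ * (θ - π) + π : ℝ) * I) -
        G ((ρ * Real.log (R * r) : ℝ) + (ρ * (θ - π) - π : ℝ) * I)) := by
  have hr0 : 0 < r := by linarith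
  have hrC : (r : ℂ) ≠ 0 := ofReal_ne_zero.2 hr0.ne'
  have hq := mul_exp_neg_div_eq (θ := θ) hρ hR hr0
  have hp1 : ρ * (θ - π) + π = ρ * (θ + (π / ρ - π)) := by field_simp; ring
  have hp2 : ρ * (θ - π) - π = ρ * (θ + (-(π / ρ) - π)) := by field_simp; ring
  have he1 : exp ((-(π / ρ - π) : ℝ) * I) = -exp ((-(π / ρ) : ℝ) * I) := by
    rw [show ((-(π / ρ - π) : ℝ) : ℂ) * I = (-(π / ρ) : ℝ) * I + π * I by push_cast; ring,
      exp_add, exp_pi_mul_I, mul_neg_one]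
  have he2 : exp ((-(-(π / ρ) - π) : ℝ) * I) = -exp ((π / ρ : ℝ) * I) := by
    rw [show ((-(-(π / ρ) - π) : ℝ) : ℂ) * I = (π / ρ : ℝ) * I + π * I by push_cast; ring,
      exp_add, exp_pi_mul_I, mul_neg_one]
  rw [hG, hG, hankelKernel_add_pi, hankelKernel_sub_pi, hp1, hp2, hq, hq, he1, he2]
  have hn1 := ofReal_add_exp_ne_zero hr (-(π / ρ))
  have hn2 := ofReal_add_exp_ne_zero hr (π / ρ)
  have hee : exp ((π / ρ : ℝ) * I) * exp ((-(π / ρ) : ℝ) * I) = 1 := by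
    rw [← exp_add, ← exp_zero]
    congr 1
    push_cast
    ring
  have hcos : ((Real.cos (π / ρ) : ℝ) : ℂ) =
      (exp ((π / ρ : ℝ) * I) + exp ((-(π / ρ) : ℝ) * I)) / 2 := by
    rw [ofReal_cos, cos, ofReal_neg]
  have hD : ((r ^ 2 + 2 * r * Real.cos (π / ρ) + 1 : ℝ) : ℂ) =
      (r + exp ((-(π / ρ) : ℝ) * I)) * (r + exp ((π / ρ : ℝ) * I)) := by
    push_cast [-ofReal_cos]
    rw [hcos]
    push_cast at hee ⊢
    linear_combination -hee
  have hs1 : 2 * I * sin (π * (1 - μ)) =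
      exp ((1 - μ) * (π * I)) - exp (-((1 - μ) * (π * I))) := by
    rw [sin, show -(π * (1 - μ)) * I = -((1 - μ) * (π * I)) by ring,
      show π * (1 - μ) * I = (1 - μ) * (π * I) by ring]
    linear_combination (exp (-((1 - μ) * (π * I))) - exp ((1 - μ) * (π * I))) * I_sq
  have hs2 : 2 * I * sin (π * (1 - μ) + π / ρ) =
      exp ((1 - μ) * (π * I)) * exp ((π / ρ : ℝ) * I) -
        exp (-((1 - μ) * (π * I))) * exp ((-(π / ρ) : ℝ) * I) := by
    rw [sin, ← exp_add, ← exp_add,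
      show -(π * (1 - μ) + π / ρ) * I = -((1 - μ) * (π * I)) + (-(π / ρ) : ℝ) * I by
        push_cast; ring,
      show (π * (1 - μ) + π / ρ) * I = (1 - μ) * (π * I) + (π / ρ : ℝ) * I by push_cast; ring]
    linear_combination (exp (-((1 - μ) * (π * I)) + (-(π / ρ) : ℝ) * I) -
      exp ((1 - μ) * (π * I) + (π / ρ : ℝ) * I)) * I_sq
  have hL : (ρ : ℂ) * (Real.log (R * r) + I * (θ - π : ℝ)) =
      (ρ * Real.log (R * r) : ℝ) + (ρ * (θ - π) : ℝ) * I := by push_cast; ring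
  have hL' : (ρ : ℂ) * (1 - μ) * (Real.log (R * r) + I * (θ - π : ℝ)) =
      (1 - μ) * ((ρ * Real.log (R * r) : ℝ) + (ρ * (θ - π) : ℝ) * I) := by
    rw [← hL]; ring
  have hπ : (π : ℂ) ≠ 0 := ofReal_ne_zero.2 Real.pi_ne_zero
  rw [KpiF, hL, hL', hD, exp_add (-exp _)]
  generalize exp ((1 - μ) * ((ρ * Real.log (R * r) : ℝ) + (ρ * (θ - π) : ℝ) * I)) = A
  generalize exp (-exp ((ρ * Real.log (R * r) : ℝ) + (ρ * (θ - π) : ℝ) * I)) = E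
  generalize exp ((-(π / ρ) : ℝ) * I) = u at *
  generalize exp ((π / ρ : ℝ) * I) = v at *
  generalize exp ((1 - μ) * (π * I)) = p at *
  generalize exp (-((1 - μ) * (π * I))) = p' at *
  generalize sin (π * (1 - μ)) = S at *
  generalize sin (π * (1 - μ) + π / ρ) = T at *
  have hr1 : 1 - -u / r = (r + u) / r := by field_simp; ring
  have hr2 : 1 - -v / r = (r + v) / r := by field_simp; ring
  rw [hr1, hr2]
  push_cast
  field_simp
  linear_combination A * E * ρ * (r * hs1 + hs2)

lemma PF_eq {ρ R θ r : ℝ} (μ : ℂ) (hρ : 0 < ρ) (hR : 0 < R) (hr : 1 < r)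
    {G : ℂ → ℂ} (hG : ∀ L, G L = hankelKernel μ L /
      (1 - (R : ℂ) * exp (I * θ) * exp (-L / ρ))) (φ : ℝ) :
    2 * π * PF ρ μ R θ r φ =
      ρ * G ((ρ * Real.log (R * r) : ℝ) + (ρ * (θ + φ) : ℝ) * I) := by
  have hr0 : 0 < r := by linarith
  have hrC : (r : ℂ) ≠ 0 := ofReal_ne_zero.2 hr0.ne'
  have hπ : (π : ℂ) ≠ 0 := ofReal_ne_zero.2 Real.pi_ne_zero
  have hshift (x : ℝ) : exp ((x + π : ℝ) * I) = -exp (x * I) := by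
    rw [ofReal_add, add_mul, exp_add, exp_pi_mul_I, mul_neg_one]
  have hn1 : (r : ℂ) - exp (φ * I) ≠ 0 := by
    simpa only [hshift, ← sub_eq_add_neg] using ofReal_add_exp_ne_zero hr (φ + π)
  have hn2 : (r : ℂ) - exp ((-φ : ℝ) * I) ≠ 0 := by
    simpa only [hshift, ← sub_eq_add_neg] using ofReal_add_exp_ne_zero hr (-φ + π)
  have hee : exp (φ * I) * exp ((-φ : ℝ) * I) = 1 := by
    rw [← exp_add, ← exp_zero]
    congr 1
    push_cast
    ring
  have hcos : ((Real.cos φ : ℝ) : ℂ) = (exp (φ * I) + exp ((-φ : ℝ) * I)) / 2 := by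
    rw [ofReal_cos, cos, ofReal_neg]
  have hD : ((r ^ 2 - 2 * r * Real.cos φ + 1 : ℝ) : ℂ) =
      (r - exp (φ * I)) * (r - exp ((-φ : ℝ) * I)) := by
    push_cast [-ofReal_cos]
    rw [hcos]
    push_cast at hee ⊢
    linear_combination -hee
  have hker : hankelKernel μ ((ρ * Real.log (R * r) : ℝ) + (ρ * (θ + φ) : ℝ) * I) =
      exp (exp (ρ * (Real.log (R * r) + I * θ)) * cos (ρ * φ)) *
        exp (ρ * (1 - μ) * (Real.log (R * r) + I * θ)) *
        exp (I * chiF ρ μ R θ r φ) := by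
    have hL : ((ρ * Real.log (R * r) : ℝ) : ℂ) + (ρ * (θ + φ) : ℝ) * I =
        ρ * (Real.log (R * r) + I * θ) + ρ * φ * I := by push_cast; ring
    rw [hankelKernel, hL, exp_add _ (ρ * φ * I), exp_mul_I, chiF, ← exp_add, ← exp_add]
    congr 1
    ring
  rw [hG, mul_exp_neg_div_eq hρ hR hr0, hker, PF, hD, mul_comm I (φ : ℂ)]
  generalize exp ((-φ : ℝ) * I) = v at *
  generalize exp (φ * I) = u at *
  have hr1 : 1 - v / r = (r - v) / r := by field_simp
  rw [hr1]
  field_simp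

end

/-- Corollary 1, item 2: representation "A" with `δρ = π/ρ`, `ρ ≥ 1`. -/
theorem mittagLeffler_repr_A_piRho
    (ρ ϵ R θ : ℝ) (μ : ℂ)
    (hρ : 1 ≤ ρ) (hϵ : 0 < ϵ) (hR : 0 < R)
    (hθl : -(π / (2 * ρ)) + π < θ) (hθu : θ < π / (2 * ρ) + π) :
    ML ρ μ ((R : ℂ) * Complex.exp (Complex.I * (θ : ℂ))) =
      (∫ r in Set.Ioi (1 + ϵ), KpiF ρ μ R θ r) +
        ∫ φ in (-(π / ρ) - π)..(π / ρ - π), PF ρ μ R θ (1 + ϵ) φ := by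


  have hρ0 : 0 < ρ := by linarith
  have hb : 1 < 1 + ϵ := by linarith
  have hb0 : 0 < 1 + ϵ := by linarith
  have hα : |ρ * (θ - π)| < π / 2 := by
    have h : ρ * (π / (2 * ρ)) = π / 2 := by field_simp
    rw [abs_lt]
    constructor
    · nlinarith [mul_lt_mul_of_pos_left hθl hρ0]
    · nlinarith [mul_lt_mul_of_pos_left hθu hρ0]
  set z : ℂ := (R : ℂ) * Complex.exp (Complex.I * (θ : ℂ)) with hz
  set a : ℝ := ρ * Real.log (R * (1 + ϵ)) with ha
  have hnorm : ‖z‖ * Real.exp (-a / ρ) < 1 := by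
    have h1 : -a / ρ = -Real.log (R * (1 + ϵ)) := by rw [ha]; field_simp
    rw [hz, norm_mul, mul_comm Complex.I, Complex.norm_exp_ofReal_mul_I, Complex.norm_real,
      Real.norm_eq_abs, abs_of_pos hR, h1, Real.exp_neg, Real.exp_log (mul_pos hR hb0)]
    field_simp
    linarith
  set G : ℂ → ℂ := fun L => hankelKernel μ L / (1 - z * Complex.exp (-L / ρ)) with hGdef
  have hG (L : ℂ) : G L = hankelKernel μ L / (1 - z * Complex.exp (-L / ρ)) := rfl
  have hint (y : ℝ) (h : IntegrableOn (fun x : ℝ => hankelKernel μ (x + y * Complex.I))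
      (Set.Ioi a)) : IntegrableOn (fun x : ℝ => G (x + y * Complex.I)) (Set.Ioi a) := by
    refine integrable_div_one_sub h (by fun_prop) hnorm
      ((ae_restrict_iff' measurableSet_Ioi).2 (ae_of_all _ fun x hx => ?_))
    rw [norm_mul_exp_neg_div]
    have : a < x := hx
    gcongr
  have hK : 2 * π * Complex.I * (∫ r in Set.Ioi (1 + ϵ), KpiF ρ μ R θ r) =
      (∫ x in Set.Ioi a, G (x + (ρ * (θ - π) + π : ℝ) * Complex.I)) -
        ∫ x in Set.Ioi a, G (x + (ρ * (θ - π) - π : ℝ) * Complex.I) := by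
    rw [← MeasureTheory.integral_sub (hint _ (integrableOn_hankelKernel_add_pi hα μ a))
        (hint _ (integrableOn_hankelKernel_sub_pi hα μ a)), ha,
      ← integral_Ioi_comp_mul_log hρ0 hR hb0, ← MeasureTheory.integral_const_mul]
    exact setIntegral_congr_fun measurableSet_Ioi fun r hr =>
      KpiF_eq μ hρ0 hR (hb.trans hr) hG
  have hP : 2 * π * (∫ φ in (-(π / ρ) - π)..(π / ρ - π), PF ρ μ R θ (1 + ϵ) φ) =
      ∫ y in (ρ * (θ - π) - π)..(ρ * (θ - π) + π), G (a + y * Complex.I) := by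
    have hsub := smul_integral_comp_mul_add (a := -(π / ρ) - π) (b := π / ρ - π)
      (fun y : ℝ => G (a + y * Complex.I)) ρ (ρ * θ)
    rw [show ρ * (-(π / ρ) - π) + ρ * θ = ρ * (θ - π) - π by field_simp; ring,
      show ρ * (π / ρ - π) + ρ * θ = ρ * (θ - π) + π by field_simp; ring] at hsub
    rw [← hsub, Complex.real_smul, ← intervalIntegral.integral_const_mul,
      ← intervalIntegral.integral_const_mul]
    refine intervalIntegral.integral_congr fun φ _ => ?_
    simp only [PF_eq μ hρ0 hR hb hG]
    rw [show ρ * φ + ρ * θ = ρ * (θ + φ) by ring]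
  have hML := two_pi_I_mul_ML hα hρ0 μ hnorm
  rw [hankelIntegral, ← hK, ← hP] at hML
  refine mul_left_cancel₀ Complex.two_pi_I_ne_zero ?_
  rw [hML]
  ring
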